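/- Let ⋆ be a semistar operation on an integral domain D. If D is a ⋆̃-quasi-Prüfer domain, then D is a ⋆̃-stably strong S-domain. -/

import Mathlib

/- ## Preliminaries: general ideal-chain notions in a commutative ring -/

open Pointwise

section ChainNotions

variable {A B : Type*} [CommRing A] [CommRing B]

/-- `P` and `Q` are adjacent with respect to the class `Φ` of ideals:
`P ⊂ Q` and no ideal of the class `Φ` lies strictly between them. -/
def AdjacentFor (Φ : Ideal A → Prop) (P Q : Ideal A) : Prop :=
  P < Q ∧ ∀ I : Ideal A, Φ I → ¬(P < I ∧ I < Q)

/-- A saturated chain, consisting of ideals of the class `Φ`, of length `m`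
between `P` and `Q` (saturated: consecutive members are `Φ`-adjacent). -/
def SaturatedChainFor (Φ : Ideal A → Prop) (P Q : Ideal A) (m : ℕ) : Prop :=
  ∃ c : Fin (m + 1) → Ideal A, StrictMono c ∧ c 0 = P ∧ c (Fin.last m) = Q ∧
    (∀ i, Φ (c i)) ∧ ∀ i : Fin m, AdjacentFor Φ (c i.castSucc) (c i.succ)

/-- Catenarity with respect to the class `Φ` of ideals: for every pair `P ⊂ Q` of
`Φ`-ideals, any two saturated chains of `Φ`-ideals between `P` and `Q` have the
same (finite) length. -/
def CatenaryFor (Φ : Ideal A → Prop) : Prop :=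
  ∀ P Q : Ideal A, Φ P → Φ Q → P < Q →
    ∀ m₁ m₂ : ℕ, SaturatedChainFor Φ P Q m₁ → SaturatedChainFor Φ P Q m₂ → m₁ = m₂

/-- A chain `(0) = P₀ ⊂ P₁ ⊂ ⋯ ⊂ Pₙ` with all `Pᵢ`, `1 ≤ i ≤ n`, in the class `Φ`. -/
def DimChainFor (Φ : Ideal A → Prop) (n : ℕ) : Prop :=
  ∃ c : Fin (n + 1) → Ideal A, StrictMono c ∧ c 0 = ⊥ ∧ ∀ i, i ≠ 0 → Φ (c i)

/-- The dimension associated to the class `Φ` of (quasi-prime) ideals: the supremum of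
the lengths of chains `(0) = P₀ ⊂ P₁ ⊂ ⋯ ⊂ Pₙ` with all `Pᵢ` (`i ≥ 1`) in `Φ`. -/
noncomputable def quasiDim (Φ : Ideal A → Prop) : ℕ∞ :=
  ⨆ (n : ℕ) (_ : DimChainFor Φ n), (n : ℕ∞)

/-- The height of an ideal `P`: the supremum of lengths of strict chains of prime
ideals ending at `P`. -/
noncomputable def idealHeight (P : Ideal A) : ℕ∞ :=
  ⨆ (n : ℕ) (_ : ∃ c : Fin (n + 1) → Ideal A, StrictMono c ∧ (∀ i, (c i).IsPrime) ∧
      c (Fin.last n) = P), (n : ℕ∞)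

/-- The Krull dimension of a commutative ring, as the supremum in `ℕ∞` of the lengths
of strict chains of prime ideals. -/
noncomputable def krullDimE (A : Type*) [CommRing A] : ℕ∞ :=
  ⨆ (n : ℕ) (_ : ∃ c : Fin (n + 1) → Ideal A, StrictMono c ∧ ∀ i, (c i).IsPrime), (n : ℕ∞)

/-- Every pair of `Φ`-adjacent `Φ`-ideals `P ⊂ Q` of `A` extends, along `f : A →+* B`,
to a pair of `Ψ`-adjacent `Ψ`-ideals `P.map f ⊂ Q.map f` of `B`. -/
def ExtendsAdjacent (f : A →+* B) (Φ : Ideal A → Prop) (Ψ : Ideal B → Prop) : Prop :=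
  ∀ P Q : Ideal A, Φ P → Φ Q → AdjacentFor Φ P Q →
    Ψ (Ideal.map f P) ∧ Ψ (Ideal.map f Q) ∧ AdjacentFor Ψ (Ideal.map f P) (Ideal.map f Q)

/-- A (classically) catenary ring: any two saturated chains of primes between a fixed
pair of primes `P ⊂ Q` have the same finite length. -/
def IsCatenaryRing (A : Type*) [CommRing A] : Prop :=
  CatenaryFor (fun I : Ideal A => I.IsPrime)

/-- A (classical) S-domain: every height-one prime `P` extends to a height-one prime
`P[X]` of the polynomial ring. -/
def IsSDomain (A : Type*) [CommRing A] : Prop :=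
  ∀ P : Ideal A, P.IsPrime → idealHeight P = 1 →
    idealHeight (Ideal.map (Polynomial.C : A →+* Polynomial A) P) = 1

/-- A (classical) strong S-domain: every pair of adjacent primes `P ⊂ Q` extends to a
pair of adjacent primes `P[X] ⊂ Q[X]` of the polynomial ring. -/
def IsStrongSDomain (A : Type*) [CommRing A] : Prop :=
  ExtendsAdjacent (Polynomial.C : A →+* Polynomial A)
    (fun I : Ideal A => I.IsPrime) (fun I : Ideal (Polynomial A) => I.IsPrime)

/-- A (classical) stably strong S-domain: `A[X₁,…,Xₙ]` is a strong S-domain for all `n ≥ 1`. -/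
def IsStablyStrongSDomain (A : Type*) [CommRing A] : Prop :=
  ∀ n : ℕ, 1 ≤ n → IsStrongSDomain (MvPolynomial (Fin n) A)

/-- A (classical) Jaffard domain: finite Krull dimension, and
`dim (A[X₁,…,Xₙ]) = dim A + n` for all `n ≥ 1`. -/
def IsJaffardDomain (A : Type*) [CommRing A] : Prop :=
  krullDimE A ≠ ⊤ ∧ ∀ n : ℕ, 1 ≤ n → krullDimE (MvPolynomial (Fin n) A) = krullDimE A + n

end ChainNotions

/- ## Semistar operations -/

section Semistar

variable (R : Type*) (F : Type*) [CommRing R] [Field F] [Algebra R F]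

instance (priority := 100) : SMulCommClass F R F := SMulCommClass.symm R F F

/-- A semistar operation on a domain `R` with quotient field `F`: an operation on the
(nonzero) `R`-submodules of `F` satisfying `(xE)^⋆ = x E^⋆`, monotonicity, extensivity
and idempotency. (The value on the zero submodule is irrelevant.) -/
structure SemistarOp where
  /-- the underlying map on `R`-submodules of `F` -/
  star : Submodule R F → Submodule R F
  star_smul : ∀ x : F, x ≠ 0 → ∀ E : Submodule R F, E ≠ ⊥ → star (x • E) = x • star E
  star_mono : ∀ E G : Submodule R F, E ≠ ⊥ → G ≠ ⊥ → E ≤ G → star E ≤ star G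
  le_star : ∀ E : Submodule R F, E ≠ ⊥ → E ≤ star E
  star_idem : ∀ E : Submodule R F, E ≠ ⊥ → star (star E) = star E

variable {R F}

/-- The extension of an ideal of `R` to an `R`-submodule of `F`. -/
def idealExt (I : Ideal R) : Submodule R F := Submodule.map (Algebra.linearMap R F) I

/-- The contraction to `R` of an `R`-submodule of `F` (i.e. `E ∩ R`). -/
def idealCon (E : Submodule R F) : Ideal R := Submodule.comap (Algebra.linearMap R F) E

/-- The finite-type semistar operation `⋆_f` associated to `⋆`:
`E^{⋆_f}` is the union of `G^⋆` over all nonzero finitely generated `G ⊆ E`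
(the family is directed, so the union is the supremum). -/
noncomputable def SemistarOp.ft (s : SemistarOp R F) (E : Submodule R F) : Submodule R F :=
  ⨆ (G : Submodule R F) (_ : G.FG ∧ G ≠ ⊥ ∧ G ≤ E), s.star G

/-- `I` is a quasi-`f`-ideal (for `f` a semistar-type operation, e.g. `s.star`, `s.ft`
or `s.tilde`): `I` is nonzero and `f(I) ∩ R = I`. -/
def IsQuasiIdeal (f : Submodule R F → Submodule R F) (I : Ideal R) : Prop :=
  I ≠ ⊥ ∧ idealCon (f (idealExt I)) = I

/-- A quasi-prime: a prime quasi-ideal. -/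
def IsQuasiPrime (f : Submodule R F → Submodule R F) (I : Ideal R) : Prop :=
  I.IsPrime ∧ IsQuasiIdeal f I

/-- A quasi-maximal ideal: maximal among proper quasi-ideals. -/
def IsQuasiMax (f : Submodule R F → Submodule R F) (I : Ideal R) : Prop :=
  IsQuasiIdeal f I ∧ I ≠ ⊤ ∧ ∀ J : Ideal R, IsQuasiIdeal f J → J ≠ ⊤ → I ≤ J → I = J

/-- The stable finite-type semistar operation `⋆̃` associated to `⋆`:
`E^{⋆̃} = ⋂ { E R_P : P a quasi-⋆_f-maximal ideal }`, where
`x ∈ E R_P ↔ ∃ d ∉ P, d • x ∈ E` (each quasi-⋆_f-maximal ideal is prime); if there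
is no quasi-⋆_f-maximal ideal, `E^{⋆̃} = F`. -/
def SemistarOp.tilde (s : SemistarOp R F) (E : Submodule R F) : Submodule R F where
  carrier := {x : F | ∀ P : Ideal R, IsQuasiMax s.ft P → P.IsPrime →
    ∃ d : R, d ∉ P ∧ d • x ∈ E}
  zero_mem' := by
    intro P _ hP
    exact ⟨1, fun h => hP.ne_top ((Ideal.eq_top_iff_one P).mpr h), by simp⟩
  add_mem' := by
    intro x y hx hy P hPmax hP
    obtain ⟨d₁, hd₁, hdx⟩ := hx P hPmax hP
    obtain ⟨d₂, hd₂, hdy⟩ := hy P hPmax hP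
    refine ⟨d₁ * d₂, fun h => (hP.mem_or_mem h).elim hd₁ hd₂, ?_⟩
    have h₁ : (d₁ * d₂) • x ∈ E := by rw [mul_comm, mul_smul]; exact E.smul_mem d₂ hdx
    have h₂ : (d₁ * d₂) • y ∈ E := by rw [mul_smul]; exact E.smul_mem d₁ hdy
    simpa [smul_add] using E.add_mem h₁ h₂
  smul_mem' := by
    intro r x hx P hPmax hP
    obtain ⟨d, hd, hdx⟩ := hx P hPmax hP
    refine ⟨d, hd, ?_⟩
    rw [smul_smul, mul_comm, ← smul_smul]
    exact E.smul_mem r hdx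

/-- The characterization of the quasi-`⋆[n]`-prime ideals of `R[n] = R[X₁,…,Xₙ]` for the
iterated Nagata-type (stable, finite-type) semistar operation `⋆[n]` on `R[n]`:
a nonzero prime `Q` of `R[n]` is quasi-`⋆[n]`-prime iff `Q ∩ R = 0` or
`(Q ∩ R)^{⋆_f} ≠ R^⋆`. -/
def QuasiPolyPrime (s : SemistarOp R F) (n : ℕ) (Q : Ideal (MvPolynomial (Fin n) R)) : Prop :=
  Q ≠ ⊥ ∧ Q.IsPrime ∧
    (Ideal.comap (algebraMap R (MvPolynomial (Fin n) R)) Q = ⊥ ∨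
      s.ft (idealExt (Ideal.comap (algebraMap R (MvPolynomial (Fin n) R)) Q)) ≠
        s.star (idealExt (⊤ : Ideal R)))

/-- The `⋆̃`-dimension of `R`. -/
noncomputable def tildeDim (s : SemistarOp R F) : ℕ∞ := quasiDim (IsQuasiPrime s.tilde)

/-- The `⋆[n]`-dimension of `R[n] = R[X₁,…,Xₙ]`. -/
noncomputable def polyDim (s : SemistarOp R F) (n : ℕ) : ℕ∞ := quasiDim (QuasiPolyPrime s n)

/-- `R` is a `⋆̃`-S-domain: every height-one quasi-`⋆̃`-prime `P` extends to a height-one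
quasi-`⋆[1]`-prime `P[X₁]` of `R[X₁]`. -/
def TildeSDomain (s : SemistarOp R F) : Prop :=
  ∀ P : Ideal R, IsQuasiPrime s.tilde P → idealHeight P = 1 →
    QuasiPolyPrime s 1 (Ideal.map (algebraMap R (MvPolynomial (Fin 1) R)) P) ∧
    idealHeight (Ideal.map (algebraMap R (MvPolynomial (Fin 1) R)) P) = 1

/-- `R` is a `⋆̃`-strong S-domain: each pair of adjacent quasi-`⋆̃`-primes `P₁ ⊂ P₂`
extends to a pair of adjacent quasi-`⋆[1]`-primes `P₁[X₁] ⊂ P₂[X₁]` of `R[X₁]`. -/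
def TildeStrongSDomain (s : SemistarOp R F) : Prop :=
  ExtendsAdjacent (algebraMap R (MvPolynomial (Fin 1) R))
    (IsQuasiPrime s.tilde) (QuasiPolyPrime s 1)

/-- `R[n]` is a `⋆[n]`-strong S-domain: each pair of adjacent quasi-`⋆[n]`-primes
`Q₁ ⊂ Q₂` of `R[n]` extends to a pair of adjacent quasi-`⋆[n+1]`-primes
`Q₁[X_{n+1}] ⊂ Q₂[X_{n+1}]` of `R[n+1]`. -/
def PolyStrongSDomain (s : SemistarOp R F) (n : ℕ) : Prop :=
  ExtendsAdjacent (MvPolynomial.rename (Fin.castSucc : Fin n → Fin (n + 1))).toRingHom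
    (QuasiPolyPrime s n) (QuasiPolyPrime s (n + 1))

/-- `R` is a `⋆̃`-stably strong S-domain: `R[n]` is a `⋆[n]`-strong S-domain for all
`n ≥ 1`. -/
def TildeStablyStrongSDomain (s : SemistarOp R F) : Prop :=
  ∀ n : ℕ, 1 ≤ n → PolyStrongSDomain s n

/-- `R` is `⋆̃`-catenary. -/
def TildeCatenary (s : SemistarOp R F) : Prop := CatenaryFor (IsQuasiPrime s.tilde)

/-- `R[n]` is `⋆[n]`-catenary. -/
def PolyCatenary (s : SemistarOp R F) (n : ℕ) : Prop := CatenaryFor (QuasiPolyPrime s n)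

/-- `R` is `⋆̃`-universally catenarian: `R[n]` is `⋆[n]`-catenary for all `n ≥ 1`. -/
def TildeUnivCatenarian (s : SemistarOp R F) : Prop :=
  ∀ n : ℕ, 1 ≤ n → PolyCatenary s n

/-- `R` is a `⋆̃`-Jaffard domain. -/
def TildeJaffard (s : SemistarOp R F) : Prop :=
  tildeDim s ≠ ⊤ ∧ ∀ n : ℕ, 1 ≤ n → polyDim s n = tildeDim s + n

/-- `R` is `⋆̃`-Noetherian: ascending chain condition on quasi-`⋆̃`-ideals. -/
def TildeNoetherian (s : SemistarOp R F) : Prop :=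
  ∀ f : ℕ → Ideal R, (∀ i, IsQuasiIdeal s.tilde (f i)) → Monotone f →
    ∃ N : ℕ, ∀ m : ℕ, N ≤ m → f m = f N

/-- `R` is a `⋆̃`-quasi-Prüfer domain: every prime `Q` of `R[X]` with `Q ⊆ P[X]` for some
quasi-`⋆̃`-prime `P` of `R` satisfies `Q = (Q ∩ R)[X]`. -/
def TildeQuasiPrufer (s : SemistarOp R F) : Prop :=
  ∀ Q : Ideal (Polynomial R), Q.IsPrime →
    (∃ P : Ideal R, IsQuasiPrime s.tilde P ∧
      Q ≤ Ideal.map (Polynomial.C : R →+* Polynomial R) P) →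
    Q = Ideal.map (Polynomial.C : R →+* Polynomial R)
      (Ideal.comap (Polynomial.C : R →+* Polynomial R) Q)

/-- `R` is a Prüfer `⋆`-multiplication domain: `(I · (R :_F I))^{⋆_f} = R^⋆` for every
nonzero finitely generated ideal `I` of `R`. -/
def IsPStarMD (s : SemistarOp R F) : Prop :=
  ∀ I : Ideal R, I ≠ ⊥ → I.FG →
    s.ft (idealExt I * ((idealExt (⊤ : Ideal R) : Submodule R F) / idealExt I)) =
      s.star (idealExt (⊤ : Ideal R))

/-- An overring `T` of `R` (with semistar operation `⋆'`) is `(⋆,⋆')`-linked to `R`: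
for every nonzero finitely generated ideal `G` of `R`, `G^⋆ = R^⋆` implies
`(GT)^{⋆'} = T^{⋆'}`. -/
def IsLinkedOverring (s : SemistarOp R F) (T : Subalgebra R F) (s' : SemistarOp T F) : Prop :=
  ∀ G : Ideal R, G ≠ ⊥ → G.FG →
    s.star (idealExt G) = s.star (idealExt (⊤ : Ideal R)) →
      s'.star (idealExt (Ideal.map (algebraMap R T) G)) =
        s'.star (idealExt (⊤ : Ideal T))

/-- `R` is a `⋆̃`-going-down domain: for every overring `T` of `R` (a subring of `F`
containing `R`; note `F` is also the quotient field of `T`) and every semistar operation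
`⋆'` on `T`, the extension `R ⊆ T` satisfies `(⋆̃,⋆̃')`-GD. -/
def TildeGoingDown (s : SemistarOp R F) : Prop :=
  ∀ (T : Subalgebra R F) (s' : SemistarOp T F),
    ∀ P₀ P : Ideal R, IsQuasiPrime s.tilde P₀ → IsQuasiPrime s.tilde P → P₀ < P →
      ∀ Q : Ideal T, IsQuasiPrime s'.tilde Q → Ideal.comap (algebraMap R T) Q = P →
        ∃ Q₀ : Ideal T, IsQuasiPrime s'.tilde Q₀ ∧ Q₀ ≤ Q ∧
          Ideal.comap (algebraMap R T) Q₀ = P₀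

end Semistar

universe u

/-- `M` satisfies the quasi-Prüfer condition in the variables `σ`: every prime of `D[σ]` all of
whose members have their coefficients in `M` is extended from `D`. -/
def QuasiPruferAt {D : Type*} [CommRing D] (M : Ideal D) (σ : Type*) : Prop :=
  ∀ J : Ideal (MvPolynomial σ D), J.IsPrime → (∀ f ∈ J, ∀ m, f.coeff m ∈ M) →
    ∀ f ∈ J, ∀ m, MvPolynomial.C (f.coeff m) ∈ J

theorem QuasiPruferAt.mono {D : Type*} [CommRing D] {M N : Ideal D} {σ : Type*}
    (h : QuasiPruferAt N σ) (hMN : M ≤ N) : QuasiPruferAt M σ :=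
  fun J hJ hJM => h J hJ fun f hf m => hMN (hJM f hf m)

theorem QuasiPruferAt.of_surjective {D E : Type*} [CommRing D] [CommRing E] (φ : D →+* E)
    (hφ : Function.Surjective φ) {M : Ideal E} {σ : Type*}
    (h : QuasiPruferAt (M.comap φ) σ) : QuasiPruferAt M σ := by
  intro J hJ hJM f hf m
  obtain ⟨g, rfl⟩ := MvPolynomial.map_surjective φ hφ f
  have := h (J.comap (MvPolynomial.map φ)) inferInstance (fun f hf m => by
    simpa [MvPolynomial.coeff_map] using hJM _ hf m) g hf m
  simpa [MvPolynomial.coeff_map] using this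

theorem Algebra.ZariskisMainProperty.isAlgebraic {A T : Type*} [CommRing A] [CommRing T]
    [IsDomain T] [Algebra A T] [FaithfulSMul A T] {Q : Ideal T}
    (h : Algebra.ZariskisMainProperty A Q) : Algebra.IsAlgebraic A T := by
  have hinj := FaithfulSMul.algebraMap_injective A T
  have : IsDomain A := hinj.isDomain
  obtain ⟨r, hr, hri, hx⟩ := Algebra.zariskisMainProperty_iff.mp h
  have hr0 : r ≠ 0 := fun h => hr (h ▸ Q.zero_mem)
  refine ⟨fun x => ?_⟩
  obtain ⟨m, hm⟩ := hx x
  have h2 := (hri.pow m).isAlgebraic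
  exact h2.of_mul (mem_nonZeroDivisors_of_ne_zero (pow_ne_zero _ hr0)) hm.isAlgebraic

theorem quasiFiniteAt_of_isolated {A T : Type*} [CommRing A] [CommRing T] [Algebra A T]
    [Algebra.FiniteType A T] (Q : Ideal T) [Q.IsPrime]
    (hle : ∀ J : Ideal T, J.IsPrime → J ≤ Q → J.under A = Q.under A → J = Q)
    (hge : ∀ J : Ideal T, J.IsPrime → Q ≤ J → J.under A = Q.under A → J = Q) :
    Algebra.QuasiFiniteAt A Q := by
  let q : PrimeSpectrum T := ⟨Q, inferInstance⟩
  let p := q.comap (algebraMap A T)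
  let e := PrimeSpectrum.preimageHomeomorphFiber A T p
  have hmono : ∀ x y, e x ≤ e y ↔ x ≤ y :=
    fun _ _ => (PrimeSpectrum.preimageOrderIsoFiber A T p).le_iff_le
  have hle' : ∀ y, y ≤ e ⟨q, rfl⟩ → y = e ⟨q, rfl⟩ := by
    intro y hy
    obtain ⟨x, rfl⟩ := e.surjective y
    congr 1
    refine Subtype.ext (PrimeSpectrum.ext (hle x.1.asIdeal inferInstance ((hmono _ _).1 hy) ?_))
    exact congrArg PrimeSpectrum.asIdeal x.2
  have hge' : ∀ y, e ⟨q, rfl⟩ ≤ y → y = e ⟨q, rfl⟩ := by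
    intro y hy
    obtain ⟨x, rfl⟩ := e.surjective y
    congr 1
    refine Subtype.ext (PrimeSpectrum.ext (hge x.1.asIdeal inferInstance ((hmono _ _).1 hy) ?_))
    exact congrArg PrimeSpectrum.asIdeal x.2
  refine Algebra.QuasiFiniteAt.of_isOpen_singleton_fiber q ?_
  rw [← e.isOpen_image, Set.image_singleton]
  have : IsNoetherianRing (p.asIdeal.Fiber T) :=
    Algebra.FiniteType.isNoetherianRing p.asIdeal.ResidueField _
  have : IsJacobsonRing (p.asIdeal.Fiber T) :=
    isJacobsonRing_of_finiteType (A := p.asIdeal.ResidueField)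
  refine ((PrimeSpectrum.isOpen_singleton_tfae_of_isNoetherian_of_isJacobsonRing _).out
    0 2 rfl rfl).mpr ⟨?_, ?_⟩
  · rw [PrimeSpectrum.isClosed_singleton_iff_isMaximal, ← PrimeSpectrum.isMax_iff]
    exact fun y hy => (hge' y hy).le
  · intro x y hxy hx
    rw [Set.mem_singleton_iff] at hx ⊢
    subst hx
    exact hle' y ((PrimeSpectrum.le_iff_specializes _ _).2 hxy)

theorem QuasiPruferAt.eq_bot_of_comap_eq_bot {D T : Type u} [CommRing D] [CommRing T] [IsDomain T]
    [Algebra D T] [FaithfulSMul D T] [Algebra.FiniteType D T] (Q : Ideal T) [Q.IsPrime]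
    (hQ : ∀ J : Ideal T, J.IsPrime → J ≤ Q → J = ⊥ ∨ J = Q) (hq : Q.under D ≠ ⊥)
    (hqp : ∀ σ : Type u, QuasiPruferAt (Q.under D) σ) (I : Ideal (Polynomial T)) [I.IsPrime]
    (hI : ∀ t : T, Polynomial.C t ∈ I → t = 0) (hIQ : ∀ f ∈ I, ∀ n, f.coeff n ∈ Q) : I = ⊥ := by
  classical
  have hinj := FaithfulSMul.algebraMap_injective D T
  have : IsDomain D := hinj.isDomain
  obtain ⟨ι, x, hx⟩ := exists_isTranscendenceBasis' (D ⧸ Q.under D) (T ⧸ Q)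
  choose t ht using fun i => Ideal.Quotient.mk_surjective (x i)
  obtain ⟨g, hgX⟩ : ∃ g : MvPolynomial ι D →ₐ[D] T, ∀ i, g (MvPolynomial.X i) = t i :=
    ⟨MvPolynomial.aeval t, fun i => MvPolynomial.aeval_X t i⟩
  have hgC : ∀ d, g (MvPolynomial.C d) = algebraMap D T d := g.commutes
  let : Algebra (MvPolynomial ι D) T := g.toRingHom.toAlgebra
  have hgA : ∀ f, algebraMap (MvPolynomial ι D) T f = g f := fun f => rfl
  have : IsScalarTower D (MvPolynomial ι D) T := IsScalarTower.of_algebraMap_eq fun d => by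
    rw [hgA, MvPolynomial.algebraMap_eq, hgC]
  have : Algebra.FiniteType (MvPolynomial ι D) T :=
    Algebra.FiniteType.of_restrictScalars_finiteType D (MvPolynomial ι D) T
  have hmk : ∀ f : MvPolynomial ι D, Ideal.Quotient.mk Q (g f) =
      MvPolynomial.aeval x (MvPolynomial.map (Ideal.Quotient.mk (Q.under D)) f) := by
    intro f
    induction f using MvPolynomial.induction_on with
    | C a => simp [hgC]
    | add p q hp hq => simp [hp, hq]
    | mul_X p i hp => simp [hp, hgX, ht]
  have hgQ : ∀ f : MvPolynomial ι D, g f ∈ Q → ∀ m, algebraMap D T (f.coeff m) ∈ Q := by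
    intro f hf m
    have h0 := hmk f
    rw [Ideal.Quotient.eq_zero_iff_mem.mpr hf] at h0
    have h1 := hx.1 (h0.symm.trans (map_zero _).symm)
    have h2 := congrArg (MvPolynomial.coeff m) h1
    rw [MvPolynomial.coeff_map, MvPolynomial.coeff_zero, Ideal.Quotient.eq_zero_iff_mem] at h2
    exact h2
  have hginj : Function.Injective g := by
    rw [injective_iff_map_eq_zero]
    intro f hf
    ext m
    have := hqp ι (RingHom.ker g) (RingHom.ker_isPrime _) (fun f hf m => hgQ f (by
      rw [(RingHom.mem_ker).1 hf]; exact Q.zero_mem) m) f hf m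
    rw [RingHom.mem_ker, hgC] at this
    exact hinj (this.trans (map_zero _).symm)
  have : FaithfulSMul (MvPolynomial ι D) T :=
    (faithfulSMul_iff_algebraMap_injective (MvPolynomial ι D) T).2 hginj
  have : Algebra.QuasiFiniteAt (MvPolynomial ι D) Q := by
    refine quasiFiniteAt_of_isolated Q ?_ ?_
    · intro J hJ hJQ h
      refine (hQ J hJ hJQ).resolve_left ?_
      rintro rfl
      refine hq (le_bot_iff.1 fun d hd => ?_)
      have : algebraMap D (MvPolynomial ι D) d ∈ Q.under (MvPolynomial ι D) := by
        rw [Ideal.mem_comap, ← IsScalarTower.algebraMap_apply]; exact hd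
      rw [← h, Ideal.mem_comap, ← IsScalarTower.algebraMap_apply, Ideal.mem_bot] at this
      exact hinj (this.trans (map_zero _).symm)
    · intro J hJ hQJ h
      refine le_antisymm (fun y hy => ?_) hQJ
      by_contra hyQ
      have := hx.isAlgebraic
      have hne := Ideal.comap_ne_bot_of_algebraic_mem (I := J.map (Ideal.Quotient.mk Q))
        (mt Ideal.Quotient.eq_zero_iff_mem.1 hyQ) (Ideal.mem_map_of_mem _ hy)
        (Algebra.IsAlgebraic.isAlgebraic
          (R := Algebra.adjoin (D ⧸ Q.under D) (Set.range x)) (Ideal.Quotient.mk Q y))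
      refine hne (le_bot_iff.1 ?_)
      rintro ⟨z, hz⟩ hzJ
      rw [Algebra.adjoin_range_eq_range_aeval] at hz
      obtain ⟨f', rfl⟩ := hz
      obtain ⟨f, rfl⟩ := MvPolynomial.map_surjective (Ideal.Quotient.mk (Q.under D))
        Ideal.Quotient.mk_surjective f'
      have hgJ : g f ∈ J := by
        have h1 : Ideal.Quotient.mk Q (g f) ∈ J.map (Ideal.Quotient.mk Q) := by
          rw [hmk]; exact hzJ
        rw [← Ideal.mem_comap, Ideal.comap_map_of_surjective _ Ideal.Quotient.mk_surjective,
          ← RingHom.ker_eq_comap_bot, Ideal.mk_ker] at h1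
        simpa [sup_eq_left.2 hQJ] using h1
      have hgQ : f ∈ Q.under (MvPolynomial ι D) := h ▸ (show f ∈ J.under (MvPolynomial ι D) from hgJ)
      rw [Ideal.mem_bot]
      exact Subtype.ext ((hmk f).symm.trans (Ideal.Quotient.eq_zero_iff_mem.2 hgQ))
  have : Algebra.IsAlgebraic (MvPolynomial ι D) T :=
    (Algebra.ZariskisMainProperty.of_finiteType (R := (MvPolynomial ι D)) Q).isAlgebraic
  by_contra hne
  obtain ⟨y, hyI, hy0⟩ := Submodule.exists_mem_ne_zero_of_ne_bot hne
  let : Algebra (Polynomial (MvPolynomial ι D)) (Polynomial T) :=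
    (Polynomial.mapRingHom (algebraMap (MvPolynomial ι D) T)).toAlgebra
  have : Algebra.IsAlgebraic (Polynomial (MvPolynomial ι D)) (Polynomial T) :=
    inferInstanceAs (@Algebra.IsAlgebraic _ _ _ _ (Polynomial.algebra (MvPolynomial ι D) T))
  refine Ideal.comap_ne_bot_of_algebraic_mem (I := I) (R := Polynomial (MvPolynomial ι D)) hy0 hyI
    (Algebra.IsAlgebraic.isAlgebraic y) (le_bot_iff.1 fun f hf => ?_)
  have hfI : f.map (algebraMap (MvPolynomial ι D) T) ∈ I := hf
  let e := MvPolynomial.optionEquivLeft D ι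
  obtain ⟨f, rfl⟩ := e.surjective f
  let h : MvPolynomial (Option ι) D →+* Polynomial T :=
    (Polynomial.mapRingHom (algebraMap (MvPolynomial ι D) T)).comp e.toRingEquiv.toRingHom
  have hC : ∀ d, h (MvPolynomial.C d) = Polynomial.C (algebraMap D T d) := by
    intro d
    simp [h, e, hgA, hgC]
  have key := hqp (Option ι) (I.comap h) inferInstance (fun f hf m => by
    have h1 := hIQ _ hf (m none)
    have h2 : g ((e f).coeff (m none)) ∈ Q := by simpa [h, hgA] using h1
    have h3 := hgQ _ h2 m.some
    rwa [MvPolynomial.optionEquivLeft_coeff_coeff, Finsupp.optionElim_some] at h3) f hfI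
  have : f = 0 := by
    ext m
    have h1 := key m
    rw [Ideal.mem_comap, hC] at h1
    exact hinj ((hI _ h1).trans (map_zero _).symm)
  rw [this, map_zero]; rfl

theorem QuasiPruferAt.span_X {D : Type*} [CommRing D] [IsDomain D] (σ : Type*) :
    QuasiPruferAt (Ideal.span {(Polynomial.X : Polynomial D)}) σ := by
  intro J hJ hJX f hf m
  by_cases hX : MvPolynomial.C Polynomial.X ∈ J
  · obtain ⟨g, hg⟩ := Ideal.mem_span_singleton.1 (hJX f hf m)
    rw [hg, map_mul]
    exact J.mul_mem_right _ hX
  have hdiv : ∀ k : ℕ, ∀ f ∈ J, ∀ m, Polynomial.X ^ k ∣ f.coeff m := by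
    intro k
    induction k with
    | zero => simp
    | succ k ih =>
      intro f hf m
      obtain ⟨g, rfl⟩ := (MvPolynomial.C_dvd_iff_dvd_coeff Polynomial.X f).2
        fun m => Ideal.mem_span_singleton.1 (hJX f hf m)
      rw [MvPolynomial.coeff_C_mul, pow_succ']
      exact mul_dvd_mul_left _ (ih g ((hJ.mem_or_mem hf).resolve_left hX) m)
  have : f.coeff m = 0 := by
    ext n
    exact Polynomial.X_pow_dvd_iff.1 (hdiv (n + 1) f hf m) n n.lt_succ_self
  simp [this]

theorem QuasiPruferAt.eq_bot_of_adjacent_bot {D T : Type u} [CommRing D] [CommRing T] [IsDomain T]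
    [Algebra D T] [FaithfulSMul D T] [Algebra.FiniteType D T] (Q : Ideal T) [Q.IsPrime]
    (hQ : ∀ J : Ideal T, J.IsPrime → J ≤ Q → J = ⊥ ∨ J = Q)
    (hqp : ∀ σ : Type u, QuasiPruferAt (Q.under D) σ) (I : Ideal (Polynomial T)) [I.IsPrime]
    (hI : ∀ t : T, Polynomial.C t ∈ I → t = 0) (hIQ : ∀ f ∈ I, ∀ n, f.coeff n ∈ Q) : I = ⊥ := by
  by_cases hq : Q.under D = ⊥
  swap
  · exact eq_bot_of_comap_eq_bot Q hQ hq hqp I hI hIQ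
  by_cases hQ0 : Q = ⊥
  · subst hQ0
    exact le_bot_iff.1 fun f hf => Polynomial.ext fun n => hIQ f hf n
  have hinj := FaithfulSMul.algebraMap_injective D T
  have : IsDomain D := hinj.isDomain
  obtain ⟨a, haQ, ha0⟩ := Submodule.exists_mem_ne_zero_of_ne_bot hQ0
  have ha : Transcendental D a := fun h => Ideal.comap_ne_bot_of_algebraic_mem ha0 haQ h hq
  let : Algebra (Polynomial D) T := (Polynomial.aeval a : Polynomial D →ₐ[D] T).toRingHom.toAlgebra
  have hA : ∀ f : Polynomial D, algebraMap (Polynomial D) T f = Polynomial.aeval a f := fun _ => rfl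
  have : IsScalarTower D (Polynomial D) T := IsScalarTower.of_algebraMap_eq fun d => by
    rw [hA, Polynomial.algebraMap_eq, Polynomial.aeval_C]
  have : Algebra.FiniteType (Polynomial D) T :=
    Algebra.FiniteType.of_restrictScalars_finiteType D (Polynomial D) T
  have : FaithfulSMul (Polynomial D) T := (faithfulSMul_iff_algebraMap_injective _ T).2
    (transcendental_iff_injective.1 ha)
  have hspan : Q.under (Polynomial D) = Ideal.span {Polynomial.X} := by
    refine le_antisymm (fun f hf => ?_) ?_
    · rw [Ideal.mem_span_singleton, Polynomial.X_dvd_iff]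
      have h1 : Polynomial.aeval a f ∈ Q := hf
      rw [← Polynomial.divX_mul_X_add f, map_add, map_mul, Polynomial.aeval_X,
        Polynomial.aeval_C, Ideal.add_mem_iff_right _ (Q.mul_mem_left _ haQ)] at h1
      exact (Ideal.mem_bot).1 (hq ▸ (show f.coeff 0 ∈ Q.under D from h1))
    · rw [Ideal.span_singleton_le_iff_mem, Ideal.mem_comap, hA, Polynomial.aeval_X]
      exact haQ
  refine eq_bot_of_comap_eq_bot (D := Polynomial D) Q hQ ?_ (fun σ => ?_) I hI hIQ
  · rw [hspan, Ne, Ideal.span_singleton_eq_bot]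
    exact Polynomial.X_ne_zero
  · rw [hspan]
    exact QuasiPruferAt.span_X σ

/-- A prime `J` contained in a prime `P` of `B` is the kernel of a map to a valuation ring
contracting the maximal ideal to `P`. -/
theorem exists_ringHom_valuationRing {B : Type u} [CommRing B] (J P : Ideal B) [J.IsPrime]
    [P.IsPrime] (h : J ≤ P) : ∃ (V : Type u) (_ : CommRing V) (_ : IsDomain V)
      (_ : ValuationRing V) (ψ : B →+* V), RingHom.ker ψ = J ∧
        (IsLocalRing.maximalIdeal V).comap ψ = P := by
  let g : B →+* FractionRing (B ⧸ J) :=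
    (algebraMap (B ⧸ J) (FractionRing (B ⧸ J))).comp (Ideal.Quotient.mk J)
  have hg : ∀ b, g b = 0 ↔ b ∈ J := fun b => by
    rw [← Ideal.Quotient.eq_zero_iff_mem]
    exact map_eq_zero_iff _ (IsFractionRing.injective (B ⧸ J) (FractionRing (B ⧸ J)))
  have hu : ∀ y : P.primeCompl, IsUnit (g y) := fun y =>
    isUnit_iff_ne_zero.2 (mt (hg y).1 fun hy => y.2 (h hy))
  obtain ⟨A, hA, hloc⟩ := IsLocalRing.exists_factor_valuationRing
    (IsLocalization.lift hu : Localization.AtPrime P →+* FractionRing (B ⧸ J))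
  let ψ : B →+* A := ((IsLocalization.lift hu : Localization.AtPrime P →+* _).codRestrict
    A.toSubring hA).comp (algebraMap B (Localization.AtPrime P))
  have hψ : ∀ b, (ψ b : FractionRing (B ⧸ J)) = g b := fun b => IsLocalization.lift_eq hu b
  refine ⟨A, inferInstance, inferInstance, inferInstance, ψ, ?_, ?_⟩
  · ext b
    rw [RingHom.mem_ker, ← hg, ← hψ]
    exact Subtype.ext_iff
  · ext b
    rw [Ideal.mem_comap, IsLocalRing.mem_maximalIdeal, mem_nonunits_iff, not_iff_comm,
      ← Ideal.mem_primeCompl_iff, ← IsLocalization.AtPrime.isUnit_to_map_iff (Localization.AtPrime P) P]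
    exact (isUnit_map_iff ((IsLocalization.lift hu : Localization.AtPrime P →+* _).codRestrict
      A.toSubring hA) _).symm

theorem QuasiPruferAt.of_polynomial {D : Type u} [CommRing D] (M : Ideal D) [M.IsPrime]
    (h : ∀ Q : Ideal (Polynomial D), Q.IsPrime → Q ≤ M.map Polynomial.C →
      Q = (Q.comap Polynomial.C).map Polynomial.C) (σ : Type u) : QuasiPruferAt M σ := by
  classical
  intro J hJ hJM f hf
  have hP : (M.map (MvPolynomial.C : D →+* MvPolynomial σ D)).IsPrime := by
    rw [← Ideal.mk_ker (I := M), ← MvPolynomial.ker_map]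
    exact RingHom.ker_isPrime _
  obtain ⟨V, _, _, _, ψ, hker, hmax⟩ := exists_ringHom_valuationRing J
    (M.map (MvPolynomial.C : D →+* MvPolynomial σ D))
    fun f hf => MvPolynomial.mem_map_C_iff.2 (hJM f hf)
  have hψ : ∀ g, ψ g = 0 ↔ g ∈ J := fun g => by rw [← hker, RingHom.mem_ker]
  let k := IsLocalRing.ResidueField V
  let ρ : V →+* k := IsLocalRing.residue V
  have hρ : ∀ g, ρ (ψ g) = 0 ↔ ∀ m, g.coeff m ∈ M := fun g => by
    rw [← MvPolynomial.mem_map_C_iff, ← hmax, Ideal.mem_comap]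
    exact IsLocalRing.residue_eq_zero_iff _
  let θ : D →+* k := ρ.comp (ψ.comp MvPolynomial.C)
  have hθ : ∀ d, θ d = 0 ↔ d ∈ M := fun d => by
    rw [show θ d = ρ (ψ (MvPolynomial.C d)) from rfl, hρ]
    refine ⟨fun h => by simpa using h 0, fun h m => ?_⟩
    rw [MvPolynomial.coeff_C]
    split_ifs
    exacts [h, M.zero_mem]
  by_contra! hne
  obtain ⟨m₁, hm₁⟩ := hne
  obtain ⟨m₀, hm₀, hdvd⟩ : ∃ m₀, ψ (MvPolynomial.C (f.coeff m₀)) ≠ 0 ∧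
      ∀ m, ψ (MvPolynomial.C (f.coeff m₀)) ∣ ψ (MvPolynomial.C (f.coeff m)) := by
    have hm₁' : ψ (MvPolynomial.C (f.coeff m₁)) ≠ 0 := mt (hψ _).1 hm₁
    have hs : m₁ ∈ f.support := by
      rw [MvPolynomial.mem_support_iff]
      rintro h
      simp [h] at hm₁'
    obtain ⟨m₀, -, hmax⟩ := f.support.exists_max_image
      (fun m => Ideal.span {ψ (MvPolynomial.C (f.coeff m))}) ⟨m₁, hs⟩
    have hdvd : ∀ m, ψ (MvPolynomial.C (f.coeff m₀)) ∣ ψ (MvPolynomial.C (f.coeff m)) := by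
      intro m
      by_cases hm : m ∈ f.support
      · exact Ideal.span_singleton_le_span_singleton.1 (hmax m hm)
      · simp [MvPolynomial.notMem_support_iff.1 hm]
    exact ⟨m₀, fun h => hm₁' (zero_dvd_iff.1 (h ▸ hdvd m₁)), hdvd⟩
  choose w hw using hdvd
  have hw₀ : w m₀ = 1 := mul_left_cancel₀ hm₀ (by rw [← hw, mul_one])
  have halg : ∀ m, IsAlgebraic θ.range (ρ (w m)) := by
    intro m
    let φ : Polynomial D →+* V := Polynomial.eval₂RingHom (ψ.comp MvPolynomial.C) (w m)
    have hφ : ¬ RingHom.ker φ ≤ M.map Polynomial.C := by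
      intro hle
      have h1 := h _ (RingHom.ker_isPrime φ) hle
      have h2 : Polynomial.C (f.coeff m₀) * Polynomial.X - Polynomial.C (f.coeff m) ∈
          RingHom.ker φ := by
        simp [RingHom.mem_ker, φ, hw m]
      rw [h1, Ideal.mem_map_C_iff] at h2
      refine hm₀ ?_
      simpa [RingHom.mem_ker, φ, Polynomial.coeff_C] using h2 1
    obtain ⟨p, hp, hpM⟩ := SetLike.not_le_iff_exists.1 hφ
    refine ⟨p.map θ.rangeRestrict, fun h0 => hpM (Ideal.mem_map_C_iff.2 fun n => ?_), ?_⟩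
    · have := congrArg (Polynomial.coeff · n) h0
      rw [← hθ]
      simpa [Subtype.ext_iff] using this
    · rw [Polynomial.aeval_def, Polynomial.eval₂_map]
      change Polynomial.eval₂ θ (ρ (w m)) p = 0
      rw [← Polynomial.hom_eval₂]
      exact (congrArg ρ hp).trans (map_zero ρ)
  let x : σ → k := fun i => ρ (ψ (MvPolynomial.X i))
  have hx : AlgebraicIndependent θ.range x := by
    rw [algebraicIndependent_iff]
    intro g' hg'
    obtain ⟨g, rfl⟩ := MvPolynomial.map_surjective _ θ.rangeRestrict_surjective g'
    have h1 : MvPolynomial.aeval x (MvPolynomial.map θ.rangeRestrict g) = ρ (ψ g) := by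
      rw [MvPolynomial.aeval_def, MvPolynomial.eval₂_map]
      change MvPolynomial.eval₂ θ x g = _
      clear hg'
      induction g using MvPolynomial.induction_on with
      | C a => simp [θ]
      | add p q hp hq => simp [MvPolynomial.eval₂_add, hp, hq]
      | mul_X p i hp => simp [MvPolynomial.eval₂_mul, hp, x]
    ext m
    have := (hρ g).1 (h1.symm.trans hg') m
    simpa [MvPolynomial.coeff_map] using (hθ _).2 this
  have hx' := hx.subalgebraAlgebraicClosure
  rw [algebraicIndependent_iff] at hx'
  have h0 := hx' (∑ m ∈ f.support, MvPolynomial.monomial m ⟨ρ (w m), halg m⟩) (by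
    have h1 : ∑ m ∈ f.support, w m * m.prod (fun i e => ψ (MvPolynomial.X i) ^ e) = 0 := by
      refine (mul_eq_zero.1 ?_).resolve_left hm₀
      rw [← (hψ f).2 hf, Finset.mul_sum]
      conv_rhs => rw [f.as_sum, map_sum]
      refine Finset.sum_congr rfl fun m _ => ?_
      rw [← mul_assoc, ← hw, MvPolynomial.monomial_eq, map_mul, Finsupp.prod, Finsupp.prod,
        map_prod]
      simp
    have h2 := congrArg ρ h1
    rw [map_sum, map_zero] at h2
    rw [map_sum, ← h2]
    refine Finset.sum_congr rfl fun m _ => ?_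
    rw [MvPolynomial.aeval_monomial, map_mul, Finsupp.prod, Finsupp.prod, map_prod]
    simp only [map_pow]
    rfl)
  have hmem : m₀ ∈ f.support := by
    rw [MvPolynomial.mem_support_iff]
    rintro h
    simp [h] at hm₀
  have h1 := congrArg (MvPolynomial.coeff m₀) h0
  rw [MvPolynomial.coeff_sum, Finset.sum_eq_single_of_mem m₀ hmem fun m _ hm => by
    rw [MvPolynomial.coeff_monomial, if_neg hm], MvPolynomial.coeff_monomial, if_pos rfl,
    MvPolynomial.coeff_zero, Subtype.ext_iff] at h1
  have h2 : ρ (w m₀) = 0 := h1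
  rw [hw₀, map_one] at h2
  exact one_ne_zero h2

theorem QuasiPruferAt.eq_map_C_of_adjacent {D A : Type u} [CommRing D] [CommRing A] [Algebra D A]
    [Algebra.FiniteType D A] (P Q : Ideal A) [P.IsPrime] [Q.IsPrime] (hPQ : P ≤ Q)
    (hadj : ∀ J : Ideal A, J.IsPrime → P ≤ J → J ≤ Q → J = P ∨ J = Q)
    (hqp : ∀ σ : Type u, QuasiPruferAt (Q.under D) σ) (I : Ideal (Polynomial A)) [I.IsPrime]
    (hIP : I.comap Polynomial.C = P) (hIQ : I ≤ Q.map Polynomial.C) :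
    I = P.map Polynomial.C := by
  let π : A →+* A ⧸ P := Ideal.Quotient.mk P
  have hπ : Function.Surjective π := Ideal.Quotient.mk_surjective
  have hπker : RingHom.ker π = P := Ideal.mk_ker
  let ψ : Polynomial A →+* Polynomial (A ⧸ P) := Polynomial.mapRingHom π
  have hψ : Function.Surjective ψ := Polynomial.map_surjective π hπ
  have hψker : RingHom.ker ψ = P.map Polynomial.C := by
    rw [Polynomial.ker_mapRingHom, hπker]
  have hPI : P.map Polynomial.C ≤ I := Ideal.map_le_iff_le_comap.2 hIP.ge
  have hQ' : (Q.map π).IsPrime := Ideal.map_isPrime_of_surjective hπ (hπker.trans_le hPQ)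
  have hQc : (Q.map π).comap π = Q := by
    rw [Ideal.comap_map_of_surjective π hπ, ← RingHom.ker_eq_comap_bot, hπker, sup_eq_left.2 hPQ]
  have hI' : (I.map ψ).IsPrime := Ideal.map_isPrime_of_surjective hψ (hψker.trans_le hPI)
  have hIc : (I.map ψ).comap ψ = I := by
    rw [Ideal.comap_map_of_surjective ψ hψ, ← RingHom.ker_eq_comap_bot, hψker, sup_eq_left.2 hPI]
  let R := (algebraMap D (A ⧸ P)).range
  let : Algebra D R := (algebraMap D (A ⧸ P)).rangeRestrict.toAlgebra
  have : IsScalarTower D R (A ⧸ P) := IsScalarTower.of_algebraMap_eq fun _ => rfl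
  have : Algebra.FiniteType D (A ⧸ P) := inferInstance
  have : Algebra.FiniteType R (A ⧸ P) := Algebra.FiniteType.of_restrictScalars_finiteType D R _
  have : FaithfulSMul R (A ⧸ P) :=
    (faithfulSMul_iff_algebraMap_injective R (A ⧸ P)).2 Subtype.val_injective
  have hbot : I.map ψ = ⊥ := by
    refine QuasiPruferAt.eq_bot_of_adjacent_bot (D := R) (Q.map π) ?_ (fun σ => ?_) _ ?_ ?_
    · intro J hJ hJQ
      have h1 := hadj (J.comap π) inferInstance
        (hπker.ge.trans (Ideal.comap_mono bot_le)) (by rw [← hQc]; exact Ideal.comap_mono hJQ)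
      rw [← Ideal.map_comap_of_surjective π hπ J]
      refine h1.imp (fun h => ?_) fun h => by rw [h]
      rw [h, Ideal.map_eq_bot_iff_le_ker, hπker]
    · refine QuasiPruferAt.of_surjective (algebraMap D (A ⧸ P)).rangeRestrict
        (algebraMap D (A ⧸ P)).rangeRestrict_surjective ((hqp σ).mono ?_)
      intro d hd
      rw [← hQc]
      exact hd
    · intro t ht
      obtain ⟨a, rfl⟩ := hπ t
      have : Polynomial.C a ∈ (I.map ψ).comap ψ := by simpa [ψ] using ht
      rw [hIc, ← Ideal.mem_comap, hIP] at this
      exact Ideal.Quotient.eq_zero_iff_mem.2 this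
    · intro f hf n
      obtain ⟨g, rfl⟩ := hψ f
      have hg : g ∈ I := by rw [← hIc]; exact hf
      have := Ideal.mem_map_C_iff.1 (hIQ hg) n
      simpa [ψ] using Ideal.mem_map_of_mem π this
  rw [← hIc, hbot, ← RingHom.ker_eq_comap_bot, hψker]

section SemistarLemmas

variable {R : Type*} {F : Type*} [CommRing R] [Field F] [Algebra R F]

theorem SemistarOp.mem_ft_of_mem (s : SemistarOp R F) {E G : Submodule R F} {x : F} (hG : G.FG)
    (hG0 : G ≠ ⊥) (hGE : G ≤ E) (hx : x ∈ s.star G) : x ∈ s.ft E :=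
  Submodule.mem_iSup_of_mem G (Submodule.mem_iSup_of_mem ⟨hG, hG0, hGE⟩ hx)

theorem SemistarOp.mem_ft (s : SemistarOp R F) {E : Submodule R F} (hE : E ≠ ⊥) {x : F} :
    x ∈ s.ft E ↔ ∃ G : Submodule R F, (G.FG ∧ G ≠ ⊥ ∧ G ≤ E) ∧ x ∈ s.star G := by
  obtain ⟨y, hy, hy0⟩ := Submodule.exists_mem_ne_zero_of_ne_bot hE
  have : Nonempty {G : Submodule R F // G.FG ∧ G ≠ ⊥ ∧ G ≤ E} :=
    ⟨⟨Submodule.span R {y}, Submodule.fg_span_singleton y,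
      by rwa [Ne, Submodule.span_singleton_eq_bot], (Submodule.span_singleton_le_iff_mem _ _).2 hy⟩⟩
  rw [SemistarOp.ft, iSup_subtype', Submodule.mem_iSup_of_directed, Subtype.exists]
  · simp only [exists_prop]
  · rintro ⟨G, hG, hG0, hGE⟩ ⟨H, hH, hH0, hHE⟩
    have h0 : G ⊔ H ≠ ⊥ := fun h => hG0 (le_bot_iff.1 (h ▸ le_sup_left))
    exact ⟨⟨G ⊔ H, hG.sup hH, h0, sup_le hGE hHE⟩, s.star_mono _ _ hG0 h0 le_sup_left,
      s.star_mono _ _ hH0 h0 le_sup_right⟩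

theorem SemistarOp.ft_mono (s : SemistarOp R F) {E G : Submodule R F} (h : E ≤ G) :
    s.ft E ≤ s.ft G :=
  iSup_mono fun _ => iSup_mono' fun hK => ⟨⟨hK.1, hK.2.1, hK.2.2.trans h⟩, le_rfl⟩

theorem SemistarOp.le_ft (s : SemistarOp R F) (E : Submodule R F) : E ≤ s.ft E := by
  intro x hx
  by_cases h0 : x = 0
  · rw [h0]
    exact zero_mem _
  have hne : Submodule.span R {x} ≠ ⊥ := by rwa [Ne, Submodule.span_singleton_eq_bot]
  exact s.mem_ft_of_mem (Submodule.fg_span_singleton x) hne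
    ((Submodule.span_singleton_le_iff_mem _ _).2 hx)
    (s.le_star _ hne (Submodule.mem_span_singleton_self x))

theorem SemistarOp.ft_ft_le (s : SemistarOp R F) {E : Submodule R F} (hE : E ≠ ⊥) :
    s.ft (s.ft E) ≤ s.ft E := by
  classical
  intro x hx
  have hE' : s.ft E ≠ ⊥ := fun h => hE (le_bot_iff.1 (h ▸ s.le_ft E))
  obtain ⟨G, ⟨⟨S, rfl⟩, hG0, hGE⟩, hx⟩ := (s.mem_ft hE').1 hx
  have key : ∀ S : Finset F, (∀ y ∈ S, y ∈ s.ft E) →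
      ∃ K : Submodule R F, (K.FG ∧ K ≠ ⊥ ∧ K ≤ E) ∧ ∀ y ∈ S, y ∈ s.star K := by
    intro S
    induction S using Finset.induction_on with
    | empty =>
      intro _
      obtain ⟨K, hK, -⟩ := (s.mem_ft hE).1 (zero_mem (s.ft E))
      exact ⟨K, hK, by simp⟩
    | insert y S _ ih =>
      intro hS
      obtain ⟨K, ⟨hK, hK0, hKE⟩, hKS⟩ := ih fun z hz => hS z (Finset.mem_insert_of_mem hz)
      obtain ⟨H, ⟨hH, hH0, hHE⟩, hy⟩ := (s.mem_ft hE).1 (hS y (Finset.mem_insert_self y S))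
      have h0 : K ⊔ H ≠ ⊥ := fun h => hK0 (le_bot_iff.1 (h ▸ le_sup_left))
      refine ⟨K ⊔ H, ⟨hK.sup hH, h0, sup_le hKE hHE⟩, fun z hz => ?_⟩
      obtain rfl | hz := Finset.mem_insert.1 hz
      · exact s.star_mono _ _ hH0 h0 le_sup_right hy
      · exact s.star_mono _ _ hK0 h0 le_sup_left (hKS z hz)
  obtain ⟨K, ⟨hK, hK0, hKE⟩, hKS⟩ := key S fun y hy => hGE (Submodule.subset_span hy)
  refine s.mem_ft_of_mem hK hK0 hKE ?_
  rw [← s.star_idem K hK0]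
  refine s.star_mono _ _ hG0 (fun h => hK0 (le_bot_iff.1 (h ▸ s.le_star K hK0))) ?_ hx
  exact Submodule.span_le.2 hKS

theorem algebraMap_mem_idealExt [FaithfulSMul R F] {I : Ideal R} {r : R} :
    algebraMap R F r ∈ (idealExt I : Submodule R F) ↔ r ∈ I :=
  (FaithfulSMul.algebraMap_injective R F).mem_set_image

theorem idealExt_mono {I J : Ideal R} (h : I ≤ J) : (idealExt I : Submodule R F) ≤ idealExt J :=
  Submodule.map_mono h

theorem idealExt_ne_bot [FaithfulSMul R F] {I : Ideal R} (hI : I ≠ ⊥) :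
    (idealExt I : Submodule R F) ≠ ⊥ := by
  obtain ⟨x, hx, hx0⟩ := Submodule.exists_mem_ne_zero_of_ne_bot hI
  intro h
  have h1 := (algebraMap_mem_idealExt (F := F)).2 hx
  rw [h, Submodule.mem_bot] at h1
  exact hx0 ((map_eq_zero_iff _ (FaithfulSMul.algebraMap_injective R F)).1 h1)

theorem SemistarOp.ft_eq_star_top_of_one_mem [FaithfulSMul R F] (s : SemistarOp R F) {I : Ideal R}
    (hI : I ≠ ⊥) (h : (1 : F) ∈ s.ft (idealExt I)) :
    s.ft (idealExt I) = s.star (idealExt ⊤) := by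
  have hR : (⊤ : Ideal R) ≠ ⊥ := fun h => hI (le_bot_iff.1 (h ▸ le_top))
  have hR' : (idealExt ⊤ : Submodule R F) ≠ ⊥ := idealExt_ne_bot hR
  refine le_antisymm (iSup₂_le fun G hG => ?_) fun x hx => ?_
  · exact s.star_mono _ _ hG.2.1 hR' (hG.2.2.trans (idealExt_mono le_top))
  · obtain ⟨G, ⟨hG, hG0, hGI⟩, h1⟩ := (s.mem_ft (idealExt_ne_bot hI)).1 h
    refine s.mem_ft_of_mem hG hG0 hGI ?_
    rw [← s.star_idem G hG0]
    refine s.star_mono _ _ hR' (fun h => hG0 (le_bot_iff.1 (h ▸ s.le_star G hG0))) ?_ hx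
    rintro _ ⟨r, -, rfl⟩
    simpa [Algebra.smul_def] using (s.star G).smul_mem r h1

theorem SemistarOp.exists_isQuasiPrime_tilde [FaithfulSMul R F] (s : SemistarOp R F) {I : Ideal R}
    (hI : I ≠ ⊥) (h : s.ft (idealExt I) ≠ s.star (idealExt (⊤ : Ideal R))) :
    ∃ N : Ideal R, IsQuasiPrime s.tilde N ∧ I ≤ N := by
  have hinj := FaithfulSMul.algebraMap_injective R F
  have hmem : ∀ {K : Ideal R} {r : R},
      algebraMap R F r ∈ (idealExt K : Submodule R F) ↔ r ∈ K := algebraMap_mem_idealExt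
  obtain ⟨N, -, ⟨hIN, hN1⟩, hmax⟩ := zorn_le_nonempty₀
    {K : Ideal R | I ≤ K ∧ (1 : F) ∉ s.ft (idealExt K)} (fun c hc hchain K₀ hK₀ => by
      refine ⟨sSup c, ⟨(hc hK₀).1.trans (le_sSup hK₀), fun h1 => ?_⟩, fun K => le_sSup⟩
      have hne : sSup c ≠ ⊥ := fun h =>
        hI (le_bot_iff.1 (h ▸ (hc hK₀).1.trans (le_sSup hK₀)))
      obtain ⟨_, ⟨⟨S, rfl⟩, hG0, hGI⟩, h1⟩ := (s.mem_ft (idealExt_ne_bot hne)).1 h1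
      obtain ⟨K, hK, hSK⟩ := DirectedOn.exists_mem_subset_of_finset_subset_biUnion
        (f := fun K : Ideal R => ((idealExt K : Submodule R F) : Set F)) (s := S) ⟨K₀, hK₀⟩
        (fun K hK L hL => by
          obtain ⟨M, hM, hKM, hLM⟩ := hchain.directedOn K hK L hL
          exact ⟨M, hM, idealExt_mono hKM, idealExt_mono hLM⟩) (fun x hx => by
          obtain ⟨r, hr, rfl⟩ := hGI (Submodule.subset_span hx)
          obtain ⟨K, hK, hrK⟩ := (Submodule.mem_sSup_of_directed ⟨K₀, hK₀⟩
            hchain.directedOn).1 hr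
          exact Set.mem_biUnion hK (hmem.2 hrK))
      exact (hc hK).2 (s.mem_ft_of_mem ⟨S, rfl⟩ hG0 (Submodule.span_le.2 hSK) h1))
    I ⟨le_rfl, fun h1 => h (s.ft_eq_star_top_of_one_mem hI h1)⟩
  have hmax' : ∀ K, N ≤ K → (1 : F) ∉ s.ft (idealExt K) → K ≤ N := fun K hNK hK =>
    hmax ⟨hIN.trans hNK, hK⟩ hNK
  have hN0 : N ≠ ⊥ := fun h => hI (le_bot_iff.1 (h ▸ hIN))
  have hNF := idealExt_ne_bot (F := F) hN0
  have hNtop : N ≠ ⊤ := by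
    rintro rfl
    exact hN1 (s.le_ft _ (by simpa using hmem.2 (Submodule.mem_top (x := (1 : R)))))
  have hNcon : idealCon (s.ft (idealExt N)) = N := by
    have hle : N ≤ idealCon (s.ft (idealExt N)) := fun r hr => s.le_ft _ (hmem.2 hr)
    refine le_antisymm (hmax' _ hle fun h1 => hN1 ?_) hle
    exact s.ft_ft_le hNF (s.ft_mono (Submodule.map_comap_le _ _) h1)
  have hNmax : IsQuasiMax s.ft N := by
    refine ⟨⟨hN0, hNcon⟩, hNtop, fun J hJ hJtop hNJ => le_antisymm hNJ (hmax' J hNJ fun h1 => ?_)⟩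
    refine hJtop ((Ideal.eq_top_iff_one J).2 ?_)
    rw [← hJ.2]
    simpa [idealCon] using h1
  have hNprime : N.IsPrime := by
    refine Ideal.isPrime_iff.2 ⟨hNtop, fun {a b} hab => or_iff_not_imp_left.2 fun ha => ?_⟩
    by_cases hb0 : algebraMap R F b = 0
    · rw [(map_eq_zero_iff _ hinj).1 hb0]
      exact N.zero_mem
    have h1 : (1 : F) ∈ s.ft (idealExt (N ⊔ Ideal.span {a})) := by
      by_contra h1
      exact ha (hmax' _ le_sup_left h1 (Ideal.mem_sup_right (Ideal.mem_span_singleton_self a)))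
    have hne : N ⊔ Ideal.span {a} ≠ ⊥ := fun h => hN0 (le_bot_iff.1 (h ▸ le_sup_left))
    obtain ⟨G, ⟨hG, hG0, hGN⟩, h1⟩ := (s.mem_ft (idealExt_ne_bot hne)).1 h1
    rw [← hNcon]
    refine s.mem_ft_of_mem (G := algebraMap R F b • G) (hG.map _) (fun h => hG0 ?_) ?_ ?_
    · refine le_bot_iff.1 fun x hx => ?_
      have := Submodule.smul_mem_pointwise_smul x (algebraMap R F b) G hx
      rw [h, Submodule.mem_bot, smul_eq_mul] at this
      exact (mul_eq_zero.1 this).resolve_left hb0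
    · rintro _ ⟨x, hx, rfl⟩
      obtain ⟨r, hr, rfl⟩ := hGN hx
      obtain ⟨n, hn, y, hy, rfl⟩ := Submodule.mem_sup.1 hr
      obtain ⟨c, rfl⟩ := Ideal.mem_span_singleton.1 hy
      have h2 : b * (n + a * c) ∈ N := by
        rw [mul_add, ← mul_assoc, mul_comm b a]
        exact N.add_mem (N.mul_mem_left _ hn) (N.mul_mem_right _ hab)
      simpa using hmem.2 h2
    · rw [s.star_smul _ hb0 _ hG0]
      simpa using Submodule.smul_mem_pointwise_smul 1 (algebraMap R F b) _ h1
  refine ⟨N, ⟨hNprime, hN0, le_antisymm (fun r hr => ?_) fun r hr P _ hP => ?_⟩, hIN⟩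
  · obtain ⟨d, hd, hdr⟩ := hr N hNmax hNprime
    refine (hNprime.mem_or_mem (hmem.1 ?_)).resolve_left hd
    simpa [Algebra.smul_def] using hdr
  · refine ⟨1, fun h => hP.ne_top ((Ideal.eq_top_iff_one P).2 h), ?_⟩
    rw [one_smul]
    exact hmem.2 hr

end SemistarLemmas

theorem quasiPruferAt_bot (D σ : Type*) [CommRing D] : QuasiPruferAt (⊥ : Ideal D) σ := by
  intro J _ hJ f hf m
  rw [(Ideal.mem_bot).1 (hJ f hf m), map_zero]
  exact J.zero_mem

theorem QuasiPolyPrime.of_le {R F : Type*} [CommRing R] [Field F] [Algebra R F] [FaithfulSMul R F]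
    {s : SemistarOp R F} {n : ℕ} {J Q : Ideal (MvPolynomial (Fin n) R)} (hQ : QuasiPolyPrime s n Q)
    (hJ : J.IsPrime) (hJ0 : J ≠ ⊥) (hJQ : J ≤ Q) : QuasiPolyPrime s n J := by
  refine ⟨hJ0, hJ, or_iff_not_imp_left.2 fun h0 h1 => ?_⟩
  have hle := Ideal.comap_mono (f := algebraMap R (MvPolynomial (Fin n) R)) hJQ
  obtain h | h := hQ.2.2
  · exact h0 (le_bot_iff.1 (h ▸ hle))
  · have h0' : Ideal.comap (algebraMap R (MvPolynomial (Fin n) R)) Q ≠ ⊥ :=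
      fun h => h0 (le_bot_iff.1 (h ▸ hle))
    refine h (s.ft_eq_star_top_of_one_mem h0' (s.ft_mono (idealExt_mono hle) ?_))
    rw [h1]
    have : Nontrivial R := (Submodule.nontrivial_iff R).1 ⟨_, _, h0⟩
    refine s.le_star _ (idealExt_ne_bot top_ne_bot) ?_
    simpa using (algebraMap_mem_idealExt (F := F)).2 (Submodule.mem_top (x := (1 : R)))

theorem TildeQuasiPrufer.quasiPruferAt_under {R F : Type u} [CommRing R] [Field F] [Algebra R F]
    [FaithfulSMul R F] {s : SemistarOp R F} (hs : TildeQuasiPrufer s) {n : ℕ}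
    {Q : Ideal (MvPolynomial (Fin n) R)} (hQ : QuasiPolyPrime s n Q) (σ : Type u) :
    QuasiPruferAt (Q.under R) σ := by
  by_cases h0 : Q.under R = ⊥
  · rw [h0]
    exact quasiPruferAt_bot R σ
  · obtain ⟨N, hN, hQN⟩ := s.exists_isQuasiPrime_tilde h0 (hQ.2.2.resolve_left h0)
    have := hN.1
    exact (QuasiPruferAt.of_polynomial N (fun J hJ hJN => hs J hJ ⟨N, hN, hJN⟩) σ).mono hQN

/-- The isomorphism `R[X₁,…,Xₙ₊₁] ≃ R[X₁,…,Xₙ][Xₙ₊₁]`. -/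
noncomputable def mvPolynomialLastEquiv (R : Type*) [CommRing R] (n : ℕ) :
    MvPolynomial (Fin (n + 1)) R ≃+* Polynomial (MvPolynomial (Fin n) R) :=
  ((MvPolynomial.renameEquiv R finSuccEquivLast).trans
    (MvPolynomial.optionEquivLeft R (Fin n))).toRingEquiv

theorem mvPolynomialLastEquiv_comp_rename (R : Type*) [CommRing R] (n : ℕ) :
    (mvPolynomialLastEquiv R n).toRingHom.comp
      (MvPolynomial.rename (Fin.castSucc : Fin n → Fin (n + 1))).toRingHom = Polynomial.C := by
  refine MvPolynomial.ringHom_ext (fun r => ?_) fun i => ?_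
  · simp [mvPolynomialLastEquiv]
  · simp [mvPolynomialLastEquiv]

/-- Every `⋆̃`-quasi-Prüfer domain is a `⋆̃`-stably strong S-domain. -/
theorem tildeQuasiPrufer_isTildeStablyStrongS (D : Type*) [CommRing D] [IsDomain D]
    (s : SemistarOp D (FractionRing D)) (hQP : TildeQuasiPrufer s) :
    TildeStablyStrongSDomain s := by
  intro n _ P Q hP hQ hPQ
  let e := (mvPolynomialLastEquiv D n).toRingHom
  let ι := (MvPolynomial.rename (R := D) (Fin.castSucc : Fin n → Fin (n + 1))).toRingHom
  change QuasiPolyPrime s (n + 1) (P.map ι) ∧ QuasiPolyPrime s (n + 1) (Q.map ι) ∧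
    AdjacentFor (QuasiPolyPrime s (n + 1)) (P.map ι) (Q.map ι)
  have heι : e.comp ι = Polynomial.C := mvPolynomialLastEquiv_comp_rename D n
  have he : Function.Bijective e := (mvPolynomialLastEquiv D n).bijective
  have hmape : ∀ I : Ideal (MvPolynomial (Fin n) D),
      (I.map ι).map e = I.map Polynomial.C := fun I => by rw [Ideal.map_map, heι]
  have hmap : ∀ I : Ideal (MvPolynomial (Fin n) D), I.map ι = (I.map Polynomial.C).comap e :=
    fun I => by rw [← hmape, Ideal.comap_map_of_bijective e he]
  have hcomap : ∀ I : Ideal (MvPolynomial (Fin n) D), (I.map ι).comap ι = I := fun I => by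
    rw [hmap, Ideal.comap_comap, heι]
    ext x
    rw [Ideal.mem_comap, Ideal.mem_map_C_iff]
    refine ⟨fun h => by simpa using h 0, fun h k => ?_⟩
    rw [Polynomial.coeff_C]
    split_ifs
    exacts [h, I.zero_mem]
  have hqpp : ∀ I, QuasiPolyPrime s n I → QuasiPolyPrime s (n + 1) (I.map ι) := by
    rintro I ⟨hI0, hI, h⟩
    have hprime : (I.map (Polynomial.C : _ →+* Polynomial (MvPolynomial (Fin n) D))).IsPrime :=
      Ideal.isPrime_map_C_of_isPrime
    have hcon : Ideal.comap (algebraMap D (MvPolynomial (Fin (n + 1)) D)) (I.map ι) =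
        Ideal.comap (algebraMap D (MvPolynomial (Fin n) D)) I := by
      conv_rhs => rw [← hcomap I, Ideal.comap_comap]
      congr 1
      exact (MvPolynomial.rename Fin.castSucc).comp_algebraMap.symm
    refine ⟨fun h0 => hI0 (le_bot_iff.1 ?_), hmap I ▸ inferInstance, by rwa [hcon]⟩
    rw [← hcomap I, h0, ← RingHom.ker_eq_comap_bot]
    exact ((RingHom.injective_iff_ker_eq_bot ι).1
      (MvPolynomial.rename_injective _ (Fin.castSucc_injective n))).le
  have hlt : P.map ι < Q.map ι := by
    refine lt_of_le_of_ne (Ideal.map_mono hPQ.1.le) fun h => hPQ.1.ne ?_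
    rw [← hcomap P, h, hcomap]
  refine ⟨hqpp P hP, hqpp Q hQ, hlt, fun I hI ⟨hPI, hIQ⟩ => ?_⟩
  have hPprime := hP.2.1
  have hQprime := hQ.2.1
  have hIprime := hI.2.1
  have hadj : ∀ J : Ideal (MvPolynomial (Fin n) D), J.IsPrime → P ≤ J → J ≤ Q →
      J = P ∨ J = Q := by
    intro J hJ hPJ hJQ
    by_contra! hne
    exact hPQ.2 J (hQ.of_le hJ (fun h => hP.1 (le_bot_iff.1 (h ▸ hPJ))) hJQ)
      ⟨lt_of_le_of_ne hPJ hne.1.symm, lt_of_le_of_ne hJQ hne.2⟩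
  have hIe : (I.map e).comap e = I := Ideal.comap_map_of_bijective e he
  have hIe' : (I.map e).IsPrime := Ideal.map_isPrime_of_equiv (mvPolynomialLastEquiv D n)
  have hIC : (I.map e).comap Polynomial.C = I.comap ι := by
    rw [← heι, ← Ideal.comap_comap, hIe]
  obtain h | h := hadj (I.comap ι) inferInstance (Ideal.map_le_iff_le_comap.1 hPI.le)
    ((Ideal.comap_mono hIQ.le).trans (hcomap Q).le)
  · have := QuasiPruferAt.eq_map_C_of_adjacent P Q hPQ.1.le hadj
      (hQP.quasiPruferAt_under hQ) (I.map e)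
      (hIC.trans h) ((Ideal.map_mono hIQ.le).trans (hmape Q).le)
    rw [← hIe, this, ← hmap] at hPI
    exact hPI.false
  · exact hIQ.not_ge (Ideal.map_le_iff_le_comap.2 h.ge)
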